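/- Every squarefree integer n ≥ 2 with n ∉ {2, 3, 5, 6, 10, 30} satisfies σ(n)/n < e^γ · log(log n). -/

import Mathlib

open Real Finset

/-! ### Kernel-computable primes below 1156 -/

def bp (n : ℕ) : Bool :=
  Nat.ble 2 n && (List.range 34).all (fun d => Nat.ble d 1 || Nat.ble n d || !(Nat.beq (n % d) 0))

lemma bp_iff {n : ℕ} (hn : n < 1156) : bp n = true ↔ n.Prime := by
  simp only [bp, Bool.and_eq_true, Nat.ble_eq, List.all_eq_true, List.mem_range, Bool.or_eq_true,
    Bool.not_eq_true']
  have hb : ∀ k : ℕ, Nat.beq k 0 = false ↔ k ≠ 0 := fun k => by cases k <;> simp [Nat.beq]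
  simp only [hb]
  constructor
  · rintro ⟨h2, h⟩
    by_contra hp
    have h1 := Nat.minFac_sq_le_self (by omega) hp
    have h3 : n.minFac < 34 := by nlinarith
    have h4 := (Nat.minFac_prime (n := n) (by omega)).two_le
    have h5 : n.minFac < n := by nlinarith
    rcases h _ h3 with (h6 | h6) | h6
    · omega
    · omega
    · exact h6 (Nat.mod_eq_zero_of_dvd (Nat.minFac_dvd n))
  · intro hp
    refine ⟨hp.two_le, fun d hd => ?_⟩
    by_cases h1 : d ≤ 1
    · simp [h1]
    by_cases h2 : n ≤ d
    · simp [h2]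
    right
    intro h3
    rcases (Nat.dvd_prime hp).1 (Nat.dvd_of_mod_eq_zero h3) with h | h <;> omega

def pp (g : ℕ → ℕ) : ℕ → ℕ
  | 0 => 1
  | n + 1 => pp g n * (bif bp n then g n else 1)

/-- primes up to `N` -/
def Pr (N : ℕ) : Finset ℕ := (range (N + 1)).filter Nat.Prime

lemma mem_Pr {N p : ℕ} : p ∈ Pr N ↔ p ≤ N ∧ p.Prime := by
  simp [Pr]

lemma prod_Pr (g : ℕ → ℕ) {N : ℕ} (hN : N < 1156) : ∏ p ∈ Pr N, g p = pp g (N + 1) := by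
  have : ∀ k ≤ 1156, ∏ p ∈ (range k).filter Nat.Prime, g p = pp g k := by
    intro k hk
    induction k with
    | zero => simp [pp]
    | succ k ih =>
      rw [prod_filter] at ih ⊢
      rw [prod_range_succ, ih (by omega), pp]
      congr 1
      have := bp_iff (n := k) (by omega)
      by_cases h : k.Prime
      · simp [h, this.2 h]
      · have h2 : bp k = false := by
          by_contra h3
          exact h (this.1 (by simpa using h3))
        simp [h, h2]
  exact this _ (by omega)

/-- The product of `1+1/p` -/
noncomputable def PP (N : ℕ) : ℝ := ∏ p ∈ Pr N, (1 + 1 / (p : ℝ))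

lemma PP_pos (N : ℕ) : 0 < PP N := prod_pos fun p _ => by positivity

lemma PP_le {N a b : ℕ} (hN : N < 1156) (hb : 0 < b)
    (h : pp (fun p => p + 1) (N + 1) * b ≤ a * pp (fun p => p) (N + 1)) :
    PP N ≤ a / b := by
  have h1 : PP N = (∏ p ∈ Pr N, ((p + 1 : ℕ) : ℝ)) / ∏ p ∈ Pr N, (p : ℝ) := by
    rw [PP, ← prod_div_distrib]
    refine prod_congr rfl fun p hp => ?_
    have := (mem_Pr.1 hp).2.pos
    push_cast
    field_simp
  rw [← prod_Pr _ hN, ← prod_Pr _ hN] at h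
  have h2 : (0:ℝ) < ∏ p ∈ Pr N, (p : ℝ) :=
    prod_pos fun p hp => by exact_mod_cast (mem_Pr.1 hp).2.pos
  rw [h1, div_le_div_iff₀ h2 (by exact_mod_cast hb)]
  rw [← Nat.cast_prod, ← Nat.cast_prod]
  exact_mod_cast h

lemma primorial_eq {N : ℕ} (hN : N < 1156) : primorial N = pp (fun p => p) (N + 1) :=
  prod_Pr _ hN

lemma PP_11 : PP 11 ≤ 300 / 100 := by
  exact_mod_cast PP_le (a := 300) (b := 100) (by norm_num) (by norm_num) (by decide +kernel)
lemma PP_17 : PP 17 ≤ 342 / 100 := by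
  exact_mod_cast PP_le (a := 342) (b := 100) (by norm_num) (by norm_num) (by decide +kernel)
lemma PP_47 : PP 47 ≤ 440 / 100 := by
  exact_mod_cast PP_le (a := 440) (b := 100) (by norm_num) (by norm_num) (by decide +kernel)
lemma PP_331 : PP 331 ≤ 635 / 100 := by
  exact_mod_cast PP_le (a := 635) (b := 100) (by norm_num) (by norm_num) (by decide +kernel)
lemma PP_1024 : PP 1024 ≤ 754 / 100 := by
  exact_mod_cast PP_le (a := 754) (b := 100) (by norm_num) (by norm_num) (by decide +kernel)
lemma PP_1093 : PP 1093 ≤ 762 / 100 := by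
  exact_mod_cast PP_le (a := 762) (b := 100) (by norm_num) (by norm_num) (by decide +kernel)

lemma pl_11 : primorial 11 = 2310 := by rw [primorial_eq (by norm_num)]; decide +kernel
lemma pl_17 : 510510 ≤ primorial 17 := by rw [primorial_eq (by norm_num)]; decide +kernel
lemma pl_47 : 2 ^ 59 ≤ primorial 47 := by rw [primorial_eq (by norm_num)]; decide +kernel
lemma pl_331 : 2 ^ 441 ≤ primorial 331 := by rw [primorial_eq (by norm_num)]; decide +kernel
lemma pl_1093 : 2 ^ 1530 ≤ primorial 1093 := by rw [primorial_eq (by norm_num)]; decide +kernel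

/-- Sum of `log p / p` -/
noncomputable def AA (N : ℕ) : ℝ := ∑ p ∈ Pr N, Real.log p / p

lemma AA_ge {K M N : ℕ} (hN : N < 1156)
    (h : 2 ^ K ≤ pp (fun p => p ^ (M / p)) (N + 1)) :
    (K : ℝ) * Real.log 2 ≤ M * AA N := by
  have h1 : 2 ^ K ≤ ∏ p ∈ Pr N, p ^ (M / p) := by
    rw [prod_Pr _ hN]
    exact h
  have h2 : Real.log (2 ^ K : ℕ) ≤ Real.log (∏ p ∈ Pr N, p ^ (M / p) : ℕ) :=
    Real.log_le_log (by positivity) (Nat.cast_le.2 h1)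
  have h3 : Real.log (∏ p ∈ Pr N, p ^ (M / p) : ℕ) ≤ M * AA N := by
    push_cast
    rw [Real.log_prod (fun p hp => by
      have := (mem_Pr.1 hp).2.pos
      positivity), AA, mul_sum]
    refine sum_le_sum fun p hp => ?_
    rw [Real.log_pow]
    have h4 : ((M / p : ℕ) : ℝ) ≤ M / p := Nat.cast_div_le
    have h5 : 0 ≤ Real.log p := Real.log_natCast_nonneg p
    calc _ ≤ (M / p : ℝ) * Real.log p := by gcongr
      _ = _ := by ring
  have h6 : Real.log (2 ^ K : ℕ) = K * Real.log 2 := by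
    rw [Nat.cast_pow, Real.log_pow]; norm_num
  linarith

lemma AA_1024 : 5.45 ≤ AA 1024 := by
  have h := AA_ge (K := 31700) (M := 4000) (N := 1024) (by norm_num) (by decide +kernel)
  have := Real.log_two_gt_d9
  norm_num at h this ⊢
  linarith

/-! ### First Mertens upper bound -/

lemma pow_dvd_fact {p : ℕ} (hp : 0 < p) (k : ℕ) : p ^ k ∣ (p * k).factorial := by
  induction k with
  | zero => simp
  | succ k ih =>
    obtain ⟨q, rfl⟩ : ∃ q, p = q + 1 := ⟨p - 1, by omega⟩
    have : (q + 1) * (k + 1) = ((q + 1) * k + q) + 1 := by ring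
    rw [this, Nat.factorial_succ, ← this, pow_succ, mul_comm]
    refine mul_dvd_mul (dvd_mul_right _ _) (ih.trans (Nat.factorial_dvd_factorial ?_))
    omega

lemma prod_dvd_fact (N : ℕ) : ∏ p ∈ Pr N, p ^ (N / p) ∣ N.factorial := by
  refine Finset.prod_dvd_of_isRelPrime ?_ ?_
  · intro p hp q hq hpq
    have h1 := (mem_Pr.1 hp).2
    have h2 := (mem_Pr.1 hq).2
    exact Nat.coprime_iff_isRelPrime.1 (Nat.Coprime.pow _ _ ((Nat.coprime_primes h1 h2).2 hpq))
  · intro p hp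
    exact (pow_dvd_fact (mem_Pr.1 hp).2.pos _).trans
      (Nat.factorial_dvd_factorial (Nat.mul_div_le N p))

lemma log_fact_le {N : ℕ} (hN : 1 ≤ N) :
    Real.log N.factorial ≤ N * Real.log N - N + Real.log N + 1 := by
  induction N, hN using Nat.le_induction with
  | base => simp
  | succ N hN ih =>
    have hN0 : (0:ℝ) < N := by exact_mod_cast hN
    rw [Nat.factorial_succ, Nat.cast_mul, Real.log_mul (by positivity) (by positivity)]
    have h := Real.one_sub_inv_le_log_of_pos (x := (N + 1 : ℝ) / N) (by positivity)
    rw [Real.log_div (by positivity) (by positivity)] at h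
    have h2 : (1 - ((N + 1 : ℝ) / N)⁻¹) = 1 / (N + 1) := by field_simp; ring
    rw [h2, div_le_iff₀ (by positivity)] at h
    push_cast
    nlinarith

lemma AA_le {N : ℕ} (hN : 1024 ≤ N) : AA N ≤ Real.log N + 0.395 := by
  have hN0 : (1024:ℝ) ≤ N := by exact_mod_cast hN
  have h1 : ∑ p ∈ Pr N, ((N / p : ℕ) : ℝ) * Real.log p ≤ Real.log N.factorial := by
    have := Real.log_le_log (x := ((∏ p ∈ Pr N, p ^ (N / p) : ℕ) : ℝ))
      (by
        have : 0 < ∏ p ∈ Pr N, p ^ (N / p) := prod_pos fun p hp => by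
          have := (mem_Pr.1 hp).2.pos
          positivity
        exact_mod_cast this)
      (Nat.cast_le.2 (Nat.le_of_dvd (Nat.factorial_pos N) (prod_dvd_fact N)))
    refine le_trans (le_of_eq ?_) this
    push_cast
    rw [Real.log_prod (fun p hp => by
      have := (mem_Pr.1 hp).2.pos
      positivity)]
    simp
  have h2 : ∑ p ∈ Pr N, Real.log p ≤ N * Real.log 4 := by
    have h3 : Real.log (primorial N) ≤ Real.log ((4 ^ N : ℕ) : ℝ) :=
      Real.log_le_log (by exact_mod_cast primorial_pos N) (by exact_mod_cast primorial_le_four_pow N)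
    rw [primorial] at h3
    push_cast at h3
    rw [Real.log_pow, Real.log_prod (fun p hp => by
      have := (mem_Pr.1 (show p ∈ Pr N from hp)).2.pos
      positivity)] at h3
    exact h3
  have h4 : N * AA N ≤ ∑ p ∈ Pr N, ((N / p : ℕ) : ℝ) * Real.log p + ∑ p ∈ Pr N, Real.log p := by
    rw [AA, mul_sum, ← sum_add_distrib]
    refine sum_le_sum fun p hp => ?_
    have hp0 := (mem_Pr.1 hp).2.pos
    have h5 : 0 ≤ Real.log p := Real.log_natCast_nonneg p
    have h6 : (N : ℝ) / p ≤ ((N / p : ℕ) : ℝ) + 1 := by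
      have := (Nat.lt_floor_add_one ((N : ℝ) / p)).le
      rwa [Nat.floor_div_natCast, Nat.floor_natCast] at this
    calc N * (Real.log p / p) = (N : ℝ) / p * Real.log p := by ring
      _ ≤ (((N / p : ℕ) : ℝ) + 1) * Real.log p := by gcongr
      _ = _ := by ring
  have h7 := log_fact_le (N := N) (by omega)
  have h8 : Real.log 4 = 2 * Real.log 2 := by
    rw [show (4:ℝ) = 2 ^ 2 by norm_num, Real.log_pow]; norm_num
  have h9 := Real.log_two_lt_d9
  have h10 : Real.log N ≤ N / 1024 + 10 * Real.log 2 - 1 := by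
    have := Real.log_le_sub_one_of_pos (x := (N : ℝ) / 1024) (by positivity)
    rw [Real.log_div (by positivity) (by norm_num), show (1024:ℝ) = 2 ^ 10 by norm_num, Real.log_pow] at this
    norm_num at this ⊢
    linarith
  have h11 : N * AA N ≤ N * (Real.log N + 0.395) := by
    rw [h8] at h2
    have : (N:ℝ) * Real.log 2 ≤ N * 0.6931471808 := by gcongr
    nlinarith
  exact le_of_mul_le_mul_left h11 (by linarith)

noncomputable def SS (N : ℕ) : ℝ := ∑ p ∈ Pr N, 1 / (p : ℝ)

lemma Pr_succ_prime {N : ℕ} (h : (N + 1).Prime) : Pr (N + 1) = insert (N + 1) (Pr N) := by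
  ext p
  rw [mem_insert, mem_Pr, mem_Pr]
  constructor
  · rintro ⟨h1, h2⟩
    by_cases h3 : p = N + 1
    · exact Or.inl h3
    · exact Or.inr ⟨by omega, h2⟩
  · rintro (rfl | ⟨h1, h2⟩)
    · exact ⟨le_rfl, h⟩
    · exact ⟨by omega, h2⟩

lemma Pr_succ_not {N : ℕ} (h : ¬ (N + 1).Prime) : Pr (N + 1) = Pr N := by
  ext p
  rw [mem_Pr, mem_Pr]
  constructor
  · rintro ⟨h1, h2⟩
    refine ⟨?_, h2⟩
    by_contra h3
    exact h ((show p = N + 1 by omega) ▸ h2)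
  · rintro ⟨h1, h2⟩
    exact ⟨by omega, h2⟩

lemma succ_notMem (N : ℕ) : N + 1 ∉ Pr N := by
  rw [mem_Pr]; omega

lemma SS_step {N : ℕ} (hN : 1 ≤ N) :
    SS (N + 1) - SS N = (AA (N + 1) - AA N) / Real.log (N + 1) := by
  have hl : 0 < Real.log (N + 1 : ℝ) := Real.log_pos (by
    have : (1:ℝ) ≤ N := by exact_mod_cast hN
    linarith)
  by_cases h : (N + 1).Prime
  · rw [SS, SS, AA, AA, Pr_succ_prime h, sum_insert (succ_notMem N), sum_insert (succ_notMem N)]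
    push_cast
    field_simp
    ring
  · rw [SS, SS, AA, AA, Pr_succ_not h]
    simp

lemma PP_step (N : ℕ) : PP (N + 1) ≤ PP N * Real.exp (SS (N + 1) - SS N) := by
  by_cases h : (N + 1).Prime
  · rw [PP, SS, SS, Pr_succ_prime h, prod_insert (succ_notMem N), sum_insert (succ_notMem N)]
    rw [add_sub_cancel_right, mul_comm]
    refine mul_le_mul_of_nonneg_left ?_ (PP_pos N).le
    have := Real.add_one_le_exp (1 / ((N + 1 : ℕ) : ℝ))
    linarith
  · rw [PP, SS, SS, Pr_succ_not h]
    simp [PP]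

lemma PP_SS {M N : ℕ} (h : M ≤ N) : PP N ≤ PP M * Real.exp (SS N - SS M) := by
  induction N, h using Nat.le_induction with
  | base => simp
  | succ N hN ih =>
    calc PP (N + 1) ≤ PP N * Real.exp (SS (N + 1) - SS N) := PP_step N
      _ ≤ (PP M * Real.exp (SS N - SS M)) * Real.exp (SS (N + 1) - SS N) := by gcongr
      _ = _ := by rw [mul_assoc, ← Real.exp_add]; ring_nf

lemma mertens_aux {N : ℕ} (hN : 1024 ≤ N) :
    SS N - AA N / Real.log N - Real.log (Real.log N) + 0.395 / Real.log N ≤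
    SS 1024 - AA 1024 / Real.log 1024 - Real.log (Real.log 1024) + 0.395 / Real.log 1024 := by
  induction N, hN using Nat.le_induction with
  | base => simp
  | succ N hN ih =>
    refine le_trans ?_ ih
    have hN0 : (1024:ℝ) ≤ N := by exact_mod_cast hN
    have hs := SS_step (N := N) (by omega)
    have ha := AA_le hN
    push_cast
    have hx : 0 < Real.log (N : ℝ) := Real.log_pos (by linarith)
    have hxy : Real.log (N : ℝ) ≤ Real.log (N + 1 : ℝ) := Real.log_le_log (by linarith) (by linarith)
    set x := Real.log (N : ℝ)
    set y := Real.log (N + 1 : ℝ)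
    have hy : 0 < y := by linarith
    have h := Real.one_sub_inv_le_log_of_pos (x := y / x) (by positivity)
    rw [Real.log_div hy.ne' hx.ne', inv_div] at h
    have h1 : (AA N) * (1 / x - 1 / y) ≤ (x + 0.395) * (1 / x - 1 / y) := by
      refine mul_le_mul_of_nonneg_right ha ?_
      rw [sub_nonneg]
      exact one_div_le_one_div_of_le hx hxy
    have h2 : (x + 0.395) * (1 / x - 1 / y) = 1 - x / y + 0.395 / x - 0.395 / y := by
      field_simp
      ring
    have h3 : SS (N + 1) = SS N + AA (N + 1) / y - AA N / y := by
      rw [sub_div] at hs; linarith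
    have h4 : (AA N) * (1 / x - 1 / y) = AA N / x - AA N / y := by ring
    rw [h3]
    linarith

lemma mertens {N : ℕ} (hN : 1024 ≤ N) :
    SS N - SS 1024 ≤ Real.log (Real.log N) - Real.log (Real.log 1024) + 1
      - (AA 1024 - 0.395) / Real.log 1024 := by
  have h := mertens_aux hN
  have hN0 : (1024:ℝ) ≤ N := by exact_mod_cast hN
  have hx : 0 < Real.log (N : ℝ) := Real.log_pos (by linarith)
  have h1 : AA N / Real.log N - 0.395 / Real.log N ≤ 1 := by
    rw [← sub_div, div_le_one hx]
    linarith [AA_le hN]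
  rw [sub_div]
  linarith

/-! ### Swapping -/

lemma sigma_eq {n : ℕ} (hsf : Squarefree n) :
    (ArithmeticFunction.sigma 1 n : ℝ) / n = ∏ p ∈ n.primeFactors, (1 + 1 / (p : ℝ)) := by
  have h1 : ∏ p ∈ n.primeFactors, p = n := Nat.prod_primeFactors_of_squarefree hsf
  have h2 := ArithmeticFunction.isMultiplicative_sigma (k := 1) |>.map_prod_of_prime
    n.primeFactors (fun p hp => Nat.prime_of_mem_primeFactors hp)
  rw [h1] at h2
  have h3 : (n : ℝ) = ∏ p ∈ n.primeFactors, (p : ℝ) := by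
    rw [← Nat.cast_prod, h1]
  rw [h2, h3]
  push_cast
  rw [← prod_div_distrib]
  refine prod_congr rfl fun p hp => ?_
  have hp' := Nat.prime_of_mem_primeFactors hp
  have h4 := ArithmeticFunction.sigma_one_apply_prime_pow (p := p) (i := 1) hp'
  rw [pow_one] at h4
  rw [h4]
  have := hp'.pos
  simp [sum_range_succ]
  field_simp
  ring

lemma swap {n m : ℕ} (hsf : Squarefree n) (hm : 2 ≤ m) :
    Real.log ((ArithmeticFunction.sigma 1 n : ℝ) / n) ≤ Real.log (PP m) +
      Real.log (1 + 1 / m) / Real.log m * (Real.log n - Real.log (primorial m)) := by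
  have hm0 : (2:ℝ) ≤ m := by exact_mod_cast hm
  have hlm : 0 < Real.log m := Real.log_pos (by linarith)
  have hl1 : 0 < Real.log (1 + 1 / m : ℝ) := Real.log_pos (by
    have : 0 < 1 / (m:ℝ) := by positivity
    linarith)
  set c := Real.log (1 + 1 / m) / Real.log m with hc
  have hc0 : 0 ≤ c := by positivity
  have hcm : c * Real.log m = Real.log (1 + 1 / m) := by rw [hc]; field_simp
  let f : ℕ → ℝ := fun p => Real.log (1 + 1 / (p : ℝ)) - c * Real.log p
  have key : ∑ p ∈ n.primeFactors, f p ≤ ∑ p ∈ Pr m, f p := by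
    have hneg : ∀ p ∈ n.primeFactors \ Pr m, f p ≤ 0 := by
      intro p hp
      rw [mem_sdiff, mem_Pr] at hp
      have hpp := Nat.prime_of_mem_primeFactors hp.1
      have hmp : m ≤ p := by
        by_contra hh
        exact hp.2 ⟨by omega, hpp⟩
      have hmp' : (m:ℝ) ≤ p := by exact_mod_cast hmp
      have h1 : Real.log (1 + 1 / (p:ℝ)) ≤ Real.log (1 + 1 / (m:ℝ)) := by gcongr
      have h2 : c * Real.log m ≤ c * Real.log p := by gcongr
      simp only [f]
      linarith
    have hpos : ∀ p ∈ Pr m, 0 ≤ f p := by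
      intro p hp
      rw [mem_Pr] at hp
      have hp0 : (0:ℝ) < p := by exact_mod_cast hp.2.pos
      have hmp' : (p:ℝ) ≤ m := by exact_mod_cast hp.1
      have h1 : Real.log (1 + 1 / (m:ℝ)) ≤ Real.log (1 + 1 / (p:ℝ)) := by gcongr
      have h2 : c * Real.log p ≤ c * Real.log m := by gcongr
      simp only [f]
      linarith
    have h1 := sum_inter_add_sum_sdiff n.primeFactors (Pr m) f
    have h2 : ∑ p ∈ n.primeFactors ∩ Pr m, f p ≤ ∑ p ∈ Pr m, f p :=
      sum_le_sum_of_subset_of_nonneg inter_subset_right fun p hp _ => hpos p hp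
    have h3 := sum_nonpos hneg
    linarith
  have e1 : ∑ p ∈ n.primeFactors, f p =
      Real.log ((ArithmeticFunction.sigma 1 n : ℝ) / n) - c * Real.log n := by
    have h1 : Real.log n = ∑ p ∈ n.primeFactors, Real.log (p : ℝ) := by
      rw [← Real.log_prod (fun p hp => by
        have := (Nat.prime_of_mem_primeFactors hp).pos
        positivity), ← Nat.cast_prod, Nat.prod_primeFactors_of_squarefree hsf]
    rw [sigma_eq hsf, Real.log_prod (fun p hp => by positivity), h1, mul_sum, ← sum_sub_distrib]
  have e2 : ∑ p ∈ Pr m, f p = Real.log (PP m) - c * Real.log (primorial m) := by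
    have h1 : Real.log (primorial m) = ∑ p ∈ Pr m, Real.log (p : ℝ) := by
      rw [← Real.log_prod (fun p hp => by
        have := (mem_Pr.1 hp).2.pos
        positivity), ← Nat.cast_prod]
      rfl
    rw [PP, Real.log_prod (fun p hp => by positivity), h1, mul_sum, ← sum_sub_distrib]
  rw [e1, e2] at key
  linarith

lemma sigma_pos {n : ℕ} (hsf : Squarefree n) : 0 < (ArithmeticFunction.sigma 1 n : ℝ) / n := by
  rw [sigma_eq hsf]
  exact prod_pos fun p _ => by positivity

lemma sigma_le_PP {n m : ℕ} (hsf : Squarefree n) (hm : 2 ≤ m) (h : n ≤ primorial m) :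
    (ArithmeticFunction.sigma 1 n : ℝ) / n ≤ PP m := by
  have h1 := swap hsf hm
  have hn : (0:ℝ) < n := by exact_mod_cast Nat.pos_of_ne_zero hsf.ne_zero
  have h2 : Real.log n ≤ Real.log (primorial m) := Real.log_le_log hn (by exact_mod_cast h)
  have h3 : 0 ≤ Real.log (1 + 1 / m) / Real.log m := by
    refine div_nonneg (Real.log_nonneg ?_) (Real.log_natCast_nonneg m)
    have : 0 ≤ 1 / (m:ℝ) := by positivity
    linarith
  rw [← Real.log_le_log_iff (sigma_pos hsf) (PP_pos m)]
  nlinarith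

lemma sigma_le_exp {n m : ℕ} (hsf : Squarefree n) (hm : 2 ≤ m) :
    (ArithmeticFunction.sigma 1 n : ℝ) / n ≤ PP m * Real.exp (Real.log n / (m * Real.log m)) := by
  have h1 := swap hsf hm
  have hm0 : (2:ℝ) ≤ m := by exact_mod_cast hm
  have hlm : 0 < Real.log m := Real.log_pos (by linarith)
  have h2 : Real.log (1 + 1 / m) ≤ 1 / m := by
    have := Real.log_le_sub_one_of_pos (x := 1 + 1 / (m:ℝ)) (by positivity)
    linarith
  have h3 : 0 ≤ Real.log (1 + 1 / m) / Real.log m := by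
    refine div_nonneg (Real.log_nonneg ?_) (Real.log_natCast_nonneg m)
    have : 0 ≤ 1 / (m:ℝ) := by positivity
    linarith
  have h4 : 0 ≤ Real.log (primorial m) := Real.log_natCast_nonneg _
  have h5 : 0 ≤ Real.log n := Real.log_natCast_nonneg _
  have h6 : Real.log (1 + 1 / m) / Real.log m * Real.log n ≤ Real.log n / (m * Real.log m) := by
    calc _ ≤ (1 / m) / Real.log m * Real.log n := by gcongr
      _ = _ := by field_simp
  rw [← Real.log_le_log_iff (sigma_pos hsf) (mul_pos (PP_pos m) (Real.exp_pos _)),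
    Real.log_mul (PP_pos m).ne' (Real.exp_pos _).ne', Real.log_exp]
  nlinarith

/-! ### Numerics -/

lemma exp_gamma : 1.77 ≤ Real.exp Real.eulerMascheroniConstant := by
  have h1 := Real.eulerMascheroniSeq_lt_eulerMascheroniConstant 127
  have h2 : (5.425 : ℚ) ≤ harmonic 127 := by
    rw [harmonic]
    decide +kernel
  have h2' : (5.425 : ℝ) ≤ (harmonic 127 : ℝ) := by
    have : ((5.425 : ℚ) : ℝ) ≤ (harmonic 127 : ℝ) := Rat.cast_le.2 h2
    norm_num at this ⊢
  have h3 : Real.log ((127 : ℕ) + 1 : ℝ) = 7 * Real.log 2 := by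
    rw [show ((127 : ℕ) + 1 : ℝ) = 2 ^ 7 by norm_num, Real.log_pow]; norm_num
  rw [Real.eulerMascheroniSeq, h3] at h1
  have h4 := Real.log_two_lt_d9
  have h5 : 0.5729 ≤ Real.eulerMascheroniConstant := by linarith
  refine le_trans ?_ (Real.exp_le_exp.2 h5)
  refine le_trans ?_ (Real.sum_le_exp_of_nonneg (x := 0.5729) (by norm_num) 7)
  norm_num [sum_range_succ, Nat.factorial]

lemma exp_le_of {k j : ℕ} {a : ℝ} (hj : 0 < j) (ha : 0 ≤ a) (h : (2.7182818286 : ℝ) ^ k ≤ a ^ j) :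
    Real.exp (k / j) ≤ a := by
  have hj' : (j : ℝ) ≠ 0 := by positivity
  refine le_of_pow_le_pow_left₀ hj.ne' ha ?_
  rw [← Real.exp_nat_mul, mul_div_cancel₀ _ hj', ← mul_one (k : ℝ), Real.exp_nat_mul]
  refine le_trans ?_ h
  gcongr
  exact Real.exp_one_lt_d9.le

lemma loglog_ge {n : ℕ} {a b : ℝ} (ha : 0 < a) (h1 : a ≤ Real.log n) (h2 : Real.exp b ≤ a) :
    b ≤ Real.log (Real.log n) := by
  rw [Real.le_log_iff_exp_le (by linarith)]
  linarith

/-- main criterion -/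
lemma crit {n : ℕ} {q a : ℝ} (k j : ℕ) (hj : 0 < j) (ha : 0 < a) (h1 : a ≤ Real.log n)
    (h2 : (2.7182818286 : ℝ) ^ k ≤ a ^ j) (h3 : q < 1.77 * (k / j))
    (h4 : (ArithmeticFunction.sigma 1 n : ℝ) / n ≤ q) :
    (ArithmeticFunction.sigma 1 n : ℝ) / n <
      Real.exp Real.eulerMascheroniConstant * Real.log (Real.log n) := by
  have h5 := loglog_ge ha h1 (exp_le_of hj ha.le h2)
  have h6 := exp_gamma
  have h7 : (0:ℝ) ≤ k / j := by positivity
  calc _ ≤ q := h4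
    _ < 1.77 * (k / j) := h3
    _ ≤ _ := by gcongr

lemma log_ge_of {n N k j : ℕ} (hN : N ≤ n) (hN0 : 0 < N) (hj : 0 < j)
    (h : (2.7182818286 : ℝ) ^ k ≤ (N : ℝ) ^ j) : (k / j : ℝ) ≤ Real.log n := by
  have hN' : (N:ℝ) ≤ n := by exact_mod_cast hN
  have hN0' : (0:ℝ) < N := by exact_mod_cast hN0
  rw [Real.le_log_iff_exp_le (by linarith)]
  exact (exp_le_of hj hN0'.le h).trans hN'

lemma log_ge_two_pow {n K : ℕ} (h : 2 ^ K ≤ n) : (K : ℝ) * 0.6931 ≤ Real.log n := by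
  have h1 : Real.log ((2 ^ K : ℕ) : ℝ) ≤ Real.log n :=
    Real.log_le_log (by positivity) (by exact_mod_cast h)
  rw [Nat.cast_pow, Real.log_pow] at h1
  have := Real.log_two_gt_d9
  have h2 : (K : ℝ) * 0.6931 ≤ K * Real.log 2 := by gcongr; linarith
  push_cast at h1
  linarith

lemma num_aux {x : ℝ} (hx : 0 < x) : (754 / 100) * (x / 6.931 * 1.52) < 1.77 * x := by
  norm_num
  linarith

/-! ### Large case -/

lemma large {n : ℕ} (hsf : Squarefree n) (h : (1024 : ℝ) ≤ Real.log n) :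
    (ArithmeticFunction.sigma 1 n : ℝ) / n <
      Real.exp Real.eulerMascheroniConstant * Real.log (Real.log n) := by
  obtain ⟨m, hm⟩ : ∃ m, m = ⌊Real.log n⌋₊ := ⟨_, rfl⟩
  have hm1 : 1024 ≤ m := by rw [hm]; exact Nat.le_floor (by exact_mod_cast h)
  have hm1' : (1024:ℝ) ≤ m := by exact_mod_cast hm1
  have hm2 : (m : ℝ) ≤ Real.log n := by rw [hm]; exact Nat.floor_le (by linarith)
  have hm3 : Real.log n ≤ m + 1 := by rw [hm]; exact (Nat.lt_floor_add_one _).le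
  have h1 := sigma_le_exp hsf (m := m) (by omega)
  have h2 := PP_SS hm1
  have h3 := mertens hm1
  have hl : Real.log 1024 = 10 * Real.log 2 := by
    rw [show (1024:ℝ) = 2 ^ 10 by norm_num, Real.log_pow]; norm_num
  have hl2 := Real.log_two_gt_d9
  have hl3 := Real.log_two_lt_d9
  have hlog1 : 6.931 ≤ Real.log 1024 := by rw [hl]; linarith
  have hlog2 : Real.log 1024 ≤ 6.932 := by rw [hl]; linarith
  have hlm : Real.log 1024 ≤ Real.log m := Real.log_le_log (by norm_num) hm1'
  have hA := AA_1024
  have h4 : 0.7292 ≤ (AA 1024 - 0.395) / Real.log 1024 := by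
    rw [le_div_iff₀ (by linarith)]
    linarith
  have h5 : Real.log n / (m * Real.log m) ≤ 0.1445 := by
    rw [div_le_iff₀ (by nlinarith)]
    have : (m:ℝ) * 6.931 ≤ m * Real.log m := by gcongr; linarith
    linarith
  have h6 : (ArithmeticFunction.sigma 1 n : ℝ) / n ≤
      PP 1024 * Real.exp (Real.log (Real.log m) - Real.log (Real.log 1024) + (5 / 12)) := by
    calc _ ≤ PP m * Real.exp (Real.log n / (m * Real.log m)) := h1
      _ ≤ (PP 1024 * Real.exp (SS m - SS 1024)) * Real.exp (Real.log n / (m * Real.log m)) := by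
        gcongr
      _ = PP 1024 * Real.exp (SS m - SS 1024 + Real.log n / (m * Real.log m)) := by
        rw [mul_assoc, ← Real.exp_add]
      _ ≤ _ := by
        refine mul_le_mul_of_nonneg_left (Real.exp_le_exp.2 ?_) (PP_pos _).le
        linarith
  have hlm0 : 0 < Real.log m := by linarith
  have hl0 : 0 < Real.log 1024 := by linarith
  have hE : Real.exp (5 / 12) ≤ 1.52 := by
    have := exp_le_of (k := 5) (j := 12) (a := 1.52) (by norm_num) (by norm_num) (by norm_num)
    norm_num at this ⊢
    linarith
  rw [Real.exp_add, Real.exp_sub, Real.exp_log hlm0, Real.exp_log hl0] at h6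
  have h7 : Real.log m ≤ Real.log (Real.log n) := Real.log_le_log (lt_of_lt_of_le (by norm_num) hm1') hm2
  have h8 := exp_gamma
  have h9 : Real.log m / Real.log 1024 ≤ Real.log m / 6.931 :=
    div_le_div_of_nonneg_left hlm0.le (by norm_num) hlog1
  calc _ ≤ _ := h6
    _ ≤ (754 / 100) * (Real.log m / 6.931 * 1.52) := by
      have hr : 0 ≤ Real.log m / Real.log 1024 := div_nonneg hlm0.le hl0.le
      refine mul_le_mul PP_1024 (mul_le_mul h9 hE (Real.exp_pos _).le (hr.trans h9))
        (mul_nonneg hr (Real.exp_pos _).le) (by norm_num)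
    _ < 1.77 * Real.log m := num_aux hlm0
    _ ≤ _ := mul_le_mul h8 h7 hlm0.le (Real.exp_pos _).le

/-! ### Small case -/

def sg (n : ℕ) : ℕ → ℕ
  | 0 => 0
  | k + 1 => sg n k + (bif Nat.beq (n % (k + 1)) 0 then k + 1 else 0)

lemma sigma_sg (n : ℕ) (hn : 0 < n) : ArithmeticFunction.sigma 1 n = sg n n := by
  have : ∀ k ≤ n, ∑ d ∈ (Finset.Icc 1 k).filter (fun d => d ∣ n), d = sg n k := by
    intro k hk
    induction k with
    | zero => simp [sg]
    | succ k ih =>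
      rw [sum_filter] at ih ⊢
      rw [Finset.sum_Icc_succ_top (by omega), ih (by omega), sg]
      congr 1
      by_cases h : (k + 1) ∣ n
      · have h2 := Nat.mod_eq_zero_of_dvd h
        simp [h, h2]
      · have h2 : n % (k + 1) ≠ 0 := fun h3 => h (Nat.dvd_of_mod_eq_zero h3)
        have h4 : Nat.beq (n % (k + 1)) 0 = false := by
          cases h5 : n % (k + 1) with
          | zero => exact absurd h5 h2
          | succ _ => rfl
        simp [h, h4]
  rw [ArithmeticFunction.sigma_one_apply, ← this n le_rfl]
  refine sum_congr ?_ fun _ _ => rfl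
  ext d
  simp only [Nat.mem_divisors, mem_filter, mem_Icc]
  constructor
  · rintro ⟨h1, h2⟩
    exact ⟨⟨Nat.pos_of_dvd_of_pos h1 hn, Nat.le_of_dvd hn h1⟩, h1⟩
  · rintro ⟨_, h1⟩
    exact ⟨h1, hn.ne'⟩

def sf (n : ℕ) : Bool := (List.range 21).all fun d => Nat.ble d 1 || !(Nat.beq (n % (d * d)) 0)

lemma sf_of {n : ℕ} (h : Squarefree n) : sf n = true := by
  simp only [sf, List.all_eq_true, List.mem_range, Bool.or_eq_true, Nat.ble_eq, Bool.not_eq_true']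
  intro d hd
  by_cases h1 : d ≤ 1
  · exact Or.inl h1
  right
  by_contra h2
  rw [Bool.not_eq_false, Nat.beq_eq] at h2
  have h3 := h d (Nat.dvd_of_mod_eq_zero h2)
  rw [Nat.isUnit_iff] at h3
  omega

/-- for squarefree `l ≤ n < u` other than 10, 30, sigma is bounded by `a/b` -/
def chk (l u a b : ℕ) : Bool := (List.range u).all fun n =>
  Nat.ble (n + 1) l || Nat.beq n 10 || Nat.beq n 30 || !(sf n) || Nat.ble (b * sg n n) (a * n)

lemma chk_of {l u a b n : ℕ} (h : chk l u a b = true) (hl : l ≤ n) (hu : n < u) (h0 : 0 < n)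
    (h10 : n ≠ 10) (h30 : n ≠ 30) (hsf : Squarefree n) (hb : 0 < b) :
    (ArithmeticFunction.sigma 1 n : ℝ) / n ≤ a / b := by
  simp only [chk, List.all_eq_true, List.mem_range, Bool.or_eq_true, Nat.ble_eq, Nat.beq_eq,
    Bool.not_eq_true'] at h
  have := h n hu
  rw [sf_of hsf] at this
  have h2 : b * sg n n ≤ a * n := by
    rcases this with (((h | h) | h) | h) | h
    · omega
    · exact absurd h h10
    · exact absurd h h30
    · exact absurd h (by simp)
    · exact h
  rw [sigma_sg n h0, div_le_div_iff₀ (by exact_mod_cast h0) (by exact_mod_cast hb)]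
  rw [mul_comm b] at h2
  exact_mod_cast h2

theorem squarefree_robin (n : ℕ) (hn : 2 ≤ n) (hsf : Squarefree n)
    (hne : n ∉ ({2, 3, 5, 6, 10, 30} : Set ℕ)) :
    (ArithmeticFunction.sigma 1 n : ℝ) / n <
      Real.exp Real.eulerMascheroniConstant * Real.log (Real.log n) := by
  simp only [Set.mem_insert_iff, Set.mem_singleton_iff, not_or] at hne
  obtain ⟨n2, n3, n5, n6, n10, n30⟩ := hne
  have n4 : n ≠ 4 := by
    rintro rfl
    exact absurd (sf_of hsf) (by decide)
  have h0 : 0 < n := by omega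
  by_cases c1 : n < 14
  · have h1 : (ArithmeticFunction.sigma 1 n : ℝ) / n ≤ (8 : ℕ) / (7 : ℕ) :=
      chk_of (l := 7) (u := 14) (by decide +kernel) (by omega) c1 h0 n10 n30 hsf (by norm_num)
    have h2 := log_ge_of (n := n) (N := 7) (k := 35) (j := 18) (by omega) (by norm_num)
      (by norm_num) (by norm_num)
    exact crit 65 100 (by norm_num) (by norm_num) h2 (by norm_num) (by norm_num) h1
  by_cases c2 : n < 15
  · have h1 : (ArithmeticFunction.sigma 1 n : ℝ) / n ≤ (12 : ℕ) / (7 : ℕ) :=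
      chk_of (l := 14) (u := 15) (by decide +kernel) (by omega) c2 h0 n10 n30 hsf (by norm_num)
    have h2 := log_ge_of (n := n) (N := 14) (k := 29) (j := 11) (by omega) (by norm_num)
      (by norm_num) (by norm_num)
    exact crit 31 32 (by norm_num) (by norm_num) h2 (by norm_num) (by norm_num) h1
  by_cases c3 : n < 42
  · have h1 : (ArithmeticFunction.sigma 1 n : ℝ) / n ≤ (165 : ℕ) / (100 : ℕ) :=
      chk_of (l := 15) (u := 42) (by decide +kernel) (by omega) c3 h0 n10 n30 hsf (by norm_num)
    have h2 := log_ge_of (n := n) (N := 15) (k := 27) (j := 10) (by omega) (by norm_num)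
      (by norm_num) (by norm_num)
    exact crit 98 100 (by norm_num) (by norm_num) h2 (by norm_num) (by norm_num) h1
  by_cases c4 : n < 210
  · have h1 : (ArithmeticFunction.sigma 1 n : ℝ) / n ≤ (16 : ℕ) / (7 : ℕ) :=
      chk_of (l := 42) (u := 210) (by decide +kernel) (by omega) c4 h0 n10 n30 hsf (by norm_num)
    have h2 := log_ge_of (n := n) (N := 42) (k := 37) (j := 10) (by omega) (by norm_num)
      (by norm_num) (by norm_num)
    exact crit 13 10 (by norm_num) (by norm_num) h2 (by norm_num) (by norm_num) h1
  by_cases c5 : n < 420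
  · have h1 : (ArithmeticFunction.sigma 1 n : ℝ) / n ≤ (275 : ℕ) / (100 : ℕ) :=
      chk_of (l := 210) (u := 420) (by decide +kernel) (by omega) c5 h0 n10 n30 hsf (by norm_num)
    have h2 := log_ge_of (n := n) (N := 210) (k := 53) (j := 10) (by omega) (by norm_num)
      (by norm_num) (by norm_num)
    exact crit 16 10 (by norm_num) (by norm_num) h2 (by norm_num) (by norm_num) h1
  by_cases c6 : n ≤ primorial 11
  · have h1 := (sigma_le_PP hsf (by norm_num) c6).trans PP_11
    have h2 := log_ge_of (n := n) (N := 420) (k := 60) (j := 10) (by omega) (by norm_num)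
      (by norm_num) (by norm_num)
    exact crit 175 100 (by norm_num) (by norm_num) h2 (by norm_num) (by norm_num) h1
  by_cases c7 : n ≤ primorial 17
  · have h1 := (sigma_le_PP hsf (by norm_num) c7).trans PP_17
    have h2 := log_ge_of (n := n) (N := 2310) (k := 77) (j := 10) (by rw [pl_11] at c6; omega)
      (by norm_num) (by norm_num) (by norm_num)
    exact crit 20 10 (by norm_num) (by norm_num) h2 (by norm_num) (by norm_num) h1
  by_cases c8 : n ≤ primorial 47
  · have h1 := (sigma_le_PP hsf (by norm_num) c8).trans PP_47
    have h2 := log_ge_of (n := n) (N := 510510) (k := 131) (j := 10)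
      (by have := pl_17; omega) (by norm_num) (by norm_num) (by norm_num)
    exact crit 255 100 (by norm_num) (by norm_num) h2 (by norm_num) (by norm_num) h1
  by_cases c9 : n ≤ primorial 331
  · have h1 := (sigma_le_PP hsf (by norm_num) c9).trans PP_331
    have h2 := log_ge_two_pow (n := n) (K := 59) (pl_47.trans (not_le.1 c8).le)
    exact crit 37 10 (by norm_num) (by norm_num) h2 (by norm_num) (by norm_num) h1
  by_cases c10 : n ≤ primorial 1093
  · have h1 := (sigma_le_PP hsf (by norm_num) c10).trans PP_1093
    have h2 := log_ge_two_pow (n := n) (K := 441) (pl_331.trans (not_le.1 c9).le)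
    exact crit 5 1 (by norm_num) (by norm_num) h2 (by norm_num) (by norm_num) h1
  have h2 := log_ge_two_pow (n := n) (K := 1530) (pl_1093.trans (not_le.1 c10).le)
  refine large hsf ?_
  norm_num at h2
  linarith
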